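/- Let R be a noetherian commutative ring. Then R is a Rado ring if and only if for every associated prime 𝔭 of R (as a module over itself), either R/𝔭 is a finite field or the localisation R_𝔭 is a field. -/

import Mathlib

open BigOperators

/-- A matrix `A` over `S` is partition regular over the `S`-module `M` for `r` colours if
every colouring of `M` with `r` colours admits a nonzero monochromatic solution of `A m = 0`. -/
def IsPR {S : Type*} [CommRing S] {k l : ℕ} (A : Matrix (Fin k) (Fin l) S)
    (M : Type*) [AddCommGroup M] [Module S M] (r : ℕ) : Prop :=
  ∀ χ : M → Fin r, ∃ m : Fin l → M, m ≠ 0 ∧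
    (∀ i, ∑ j, A i j • m j = 0) ∧ ∀ j j', χ (m j) = χ (m j')

/-- Partition regularity for every (positive) finite number of colours. -/
def IsPRAll {S : Type*} [CommRing S] {k l : ℕ} (A : Matrix (Fin k) (Fin l) S)
    (M : Type*) [AddCommGroup M] [Module S M] : Prop :=
  ∀ r : ℕ, 1 ≤ r → IsPR A M r

/-- The generalised columns condition of Bergelson--Deuber--Hindman--Lefmann. -/
def GenColumnsCondition {R : Type*} [CommRing R] {k l : ℕ}
    (A : Matrix (Fin k) (Fin l) R) : Prop :=
  ∃ (m : ℕ) (I : Fin (m + 1) → Finset (Fin l)) (d : Fin (m + 1) → R),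
    (∀ t, (I t).Nonempty) ∧
    (∀ t t', t ≠ t' → Disjoint (I t) (I t')) ∧
    (∀ j : Fin l, ∃ t, j ∈ I t) ∧
    (∀ t, d t ≠ 0) ∧
    (∀ i : Fin k, d 0 * ∑ j ∈ I 0, A i j = 0) ∧
    (∀ t : Fin (m + 1), 0 < t →
      (fun i : Fin k => d t * ∑ j ∈ I t, A i j) ∈
        Submodule.span R
          ((fun j (i : Fin k) => A i j) '' {j | ∃ t', t' < t ∧ j ∈ I t'})) ∧
    (0 < m → ∀ n : ℕ,
      (Set.range fun r : R =>
        d 0 * (∏ t ∈ Finset.univ.filter (fun t => t ≠ 0), d t) ^ n * r).Infinite)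

/-- A ring is a Rado ring if partition regularity over it is equivalent to the
generalised columns condition, for every matrix. -/
def IsRadoRing (R : Type*) [CommRing R] : Prop :=
  ∀ (k l : ℕ) (A : Matrix (Fin k) (Fin l) R), IsPRAll A R ↔ GenColumnsCondition A


section Deuber

variable {S : Type*} [CommRing S]

/-- All combinations of the entries of a list with coefficients in `F`. -/
def FComb (F : Set S) : List S → Set S
  | [] => {0}
  | y :: ys => {z | ∃ f ∈ F, ∃ g ∈ FComb F ys, z = f * y + g}

/-- Each level of the Deuber-type configuration is nonzero and monochromatic. -/
def Lvl (F : Set S) (d : S) {r : ℕ} (χ : S → Fin r) : List S → Prop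
  | [] => True
  | y :: ys => (∀ g ∈ FComb F ys, d * y + g ≠ 0 ∧ χ (d * y + g) = χ (d * y)) ∧ Lvl F d χ ys

theorem FComb_finite {F : Set S} (hF : F.Finite) : ∀ ys : List S, (FComb F ys).Finite
  | [] => Set.finite_singleton 0
  | y :: ys => by
    have h := Set.Finite.image2 (fun f g => f * y + g) hF (FComb_finite hF ys)
    refine h.subset ?_
    rintro z ⟨f, hf, g, hg, rfl⟩
    exact ⟨f, hf, g, hg, rfl⟩

theorem FComb_smul {F : Set S} (a : S) : ∀ (ys : List S) (g : S),
    g ∈ FComb F (ys.map (fun y => a * y)) → ∃ g' ∈ FComb F ys, g = a * g'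
  | [], g, h => ⟨0, rfl, by simpa [FComb] using h⟩
  | y :: ys, g, h => by
    obtain ⟨f, hf, g1, hg1, rfl⟩ := h
    obtain ⟨g', hg', rfl⟩ := FComb_smul a ys g1 hg1
    exact ⟨f * y + g', ⟨f, hf, g', hg', rfl⟩, by ring⟩

theorem zero_mem_FComb {F : Set S} (h0 : (0 : S) ∈ F) : ∀ ys : List S, (0 : S) ∈ FComb F ys
  | [] => rfl
  | y :: ys => ⟨0, h0, 0, zero_mem_FComb h0 ys, by ring⟩

theorem FComb_sublist {F : Set S} (h0 : (0 : S) ∈ F) {xs ys : List S} (h : xs.Sublist ys) :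
    FComb F xs ⊆ FComb F ys := by
  induction h with
  | slnil => exact le_rfl
  | cons a h ih => exact fun g hg => ⟨0, h0, g, ih hg, by ring⟩
  | cons_cons a h ih =>
    rintro g ⟨f, hf, g1, hg1, rfl⟩
    exact ⟨f, hf, g1, ih hg1, rfl⟩

theorem Lvl_sublist {F : Set S} (h0 : (0 : S) ∈ F) {d : S} {r : ℕ} {χ : S → Fin r}
    {xs ys : List S} (h : xs.Sublist ys) (hl : Lvl F d χ ys) : Lvl F d χ xs := by
  induction h with
  | slnil => exact hl
  | cons a h ih => exact ih hl.2
  | cons_cons a h ih => exact ⟨fun g hg => hl.1 g (FComb_sublist h0 h hg), ih hl.2⟩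

theorem Lvl_smul [IsDomain S] {F : Set S} {d : S} {r : ℕ} {χ : S → Fin r} {a : S} (ha : a ≠ 0) :
    ∀ (ys : List S), Lvl F d (fun x => χ (a * x)) ys → Lvl F d χ (ys.map (fun y => a * y))
  | [], _ => trivial
  | y :: ys, h => by
    refine ⟨fun g hg => ?_, Lvl_smul ha ys h.2⟩
    obtain ⟨g', hg', rfl⟩ := FComb_smul a ys g hg
    have := h.1 g' hg'
    have e : d * (a * y) + a * g' = a * (d * y + g') := by ring
    have e2 : d * (a * y) = a * (d * y) := by ring
    rw [e, e2]
    exact ⟨mul_ne_zero ha this.1, this.2⟩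

theorem exists_subsums_ne_zero [Infinite S] {ι : Type*} [DecidableEq ι] (T : Finset ι) :
    ∃ ν : ι → S, ∀ s ⊆ T, s.Nonempty → ∑ i ∈ s, ν i ≠ 0 := by
  induction T using Finset.induction_on with
  | empty =>
    refine ⟨0, fun s hs hne => ?_⟩
    rw [Finset.subset_empty.1 hs] at hne
    simp at hne
  | insert a T ha ih =>
    obtain ⟨ν, hν⟩ := ih
    obtain ⟨v, hv⟩ := ((T.powerset.finite_toSet.image (fun s => -∑ i ∈ s, ν i))).exists_notMem
    refine ⟨Function.update ν a v, fun s hs hne h => ?_⟩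
    by_cases has : a ∈ s
    · apply hv
      refine ⟨s.erase a, ?_, ?_⟩
      · simp only [Finset.coe_powerset, Set.mem_preimage, Set.mem_powerset_iff, Finset.coe_subset]
        exact Finset.subset_insert_iff.1 hs
      · rw [← Finset.add_sum_erase s _ has] at h
        have : ∑ i ∈ s.erase a, Function.update ν a v i = ∑ i ∈ s.erase a, ν i :=
          Finset.sum_congr rfl fun i hi => by
            rw [Function.update_of_ne (Finset.ne_of_mem_erase hi)]
        rw [this, Function.update_self] at h
        exact (eq_neg_of_add_eq_zero_left h).symm
    · have hsT : s ⊆ T := by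
        intro i hi
        rcases Finset.mem_insert.1 (hs hi) with rfl | h'
        · exact absurd hi has
        · exact h'
      apply hν s hsT hne
      rw [← h]
      refine Finset.sum_congr rfl fun i hi => ?_
      rw [Function.update_of_ne]
      rintro rfl
      exact has hi

theorem deuber_levels [IsDomain S] [Infinite S] {F : Set S} (hF : F.Finite) (h0 : (0 : S) ∈ F)
    {d : S} (hd : d ≠ 0) (r : ℕ) (M : ℕ) :
    ∃ L : Set (List S), L.Finite ∧ ∀ χ : S → Fin r, ∃ ys ∈ L, ys.length = M ∧ Lvl F d χ ys := by
  classical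
  induction M with
  | zero => exact ⟨{[]}, Set.finite_singleton _, fun χ => ⟨[], rfl, rfl, trivial⟩⟩
  | succ M ih =>
    obtain ⟨L, hL, hLχ⟩ := ih
    let E : Set S := ⋃ ys ∈ L, FComb F ys
    have hE : E.Finite := hL.biUnion fun ys _ => FComb_finite hF ys
    have : Finite E := hE
    obtain ⟨ι, _, hι⟩ := Combinatorics.Line.exists_mono_in_high_dimension E (Fin r)
    obtain ⟨ν, hν⟩ := exists_subsums_ne_zero (S := S) (Finset.univ : Finset ι)
    obtain ⟨z, hz⟩ := (Set.finite_range (fun w : ι → E => -∑ i, ν i * (w i : S))).exists_notMem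
    let y0 : (ι → Option E) → S := fun l => z + ∑ i, ν i * ((l i).elim 0 (fun e => (e : S)))
    let lam : (ι → Option E) → S := fun l => d * ∑ i ∈ Finset.univ.filter (fun i => l i = none), ν i
    refine ⟨Set.image2 (fun (l : ι → Option E) ys => y0 l :: ys.map (fun y => lam l * y))
      Set.univ L, Set.Finite.image2 _ Set.finite_univ hL, fun χ => ?_⟩
    obtain ⟨l, c, hc⟩ := hι fun w => χ (d * (z + ∑ i, ν i * (w i : S)))
    have hlam : lam l.idxFun ≠ 0 := by
      refine mul_ne_zero hd (hν _ (Finset.subset_univ _) ?_)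
      obtain ⟨i, hi⟩ := l.proper
      exact ⟨i, by simpa using hi⟩
    obtain ⟨ys, hys, hlen, hlvl⟩ := hLχ (fun x => χ (lam l.idxFun * x))
    refine ⟨_, ⟨l.idxFun, trivial, ys, hys, rfl⟩, by simp [hlen], ?_, Lvl_smul hlam ys hlvl⟩
    have key : ∀ e : E, d * y0 l.idxFun + lam l.idxFun * e
        = d * (z + ∑ i, ν i * (l e i : S)) := by
      intro e
      have : ∑ i, ν i * (l e i : S) = ∑ i, ν i * ((l.idxFun i).elim 0 (fun e => (e : S)))
          + (∑ i ∈ Finset.univ.filter (fun i => l.idxFun i = none), ν i) * e := by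
        rw [Finset.sum_filter, Finset.sum_mul, ← Finset.sum_add_distrib]
        refine Finset.sum_congr rfl fun i _ => ?_
        cases h : l.idxFun i with
        | none => simp [h]
        | some e' => simp [h]
      rw [this]
      simp only [y0, lam]
      ring
    have hmem : ∀ g ∈ FComb F ys, g ∈ E := fun g hg => Set.mem_biUnion hys hg
    have hcol : ∀ e : E, χ (d * y0 l.idxFun + lam l.idxFun * e) = c := by
      intro e
      rw [key e]
      exact hc e
    have h0E : (0 : S) ∈ E := hmem 0 (zero_mem_FComb h0 ys)
    have hcol0 : χ (d * y0 l.idxFun) = c := by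
      have := hcol ⟨0, h0E⟩
      simpa using this
    intro g hg
    obtain ⟨g', hg', rfl⟩ := FComb_smul _ ys g hg
    rw [hcol0]
    refine ⟨?_, hcol ⟨g', hmem _ hg'⟩⟩
    have := key ⟨g', hmem _ hg'⟩
    simp only at this
    rw [this]
    refine mul_ne_zero hd fun h => hz ⟨l ⟨g', hmem _ hg'⟩, ?_⟩
    exact (eq_neg_of_add_eq_zero_left h).symm

theorem deuber_mono [IsDomain S] [Infinite S] {F : Set S} (hF : F.Finite) (h0 : (0 : S) ∈ F)
    {d : S} (hd : d ≠ 0) (r : ℕ) (M : ℕ) (χ : S → Fin r) :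
    ∃ ys : List S, ys.length = M ∧ Lvl F d χ ys ∧ ∀ y ∈ ys, ∀ y' ∈ ys, χ (d * y) = χ (d * y') := by
  classical
  obtain ⟨L, -, hL⟩ := deuber_levels hF h0 hd r (r * M + 1)
  obtain ⟨ys, -, hlen, hlvl⟩ := hL χ
  have : ∃ c : Fin r, M ≤ (ys.filter (fun y => χ (d * y) = c)).length := by
    by_contra! hcon
    have h1 : ys.length = ∑ c : Fin r, (ys.filter (fun y => χ (d * y) = c)).length := by
      clear hcon hlvl hlen
      induction ys with
      | nil => simp
      | cons y ys ih =>
        simp only [List.filter_cons, List.length_cons]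
        rw [ih]
        have : ∀ c : Fin r, (if decide (χ (d * y) = c) = true then
            y :: List.filter (fun y => decide (χ (d * y) = c)) ys else
            List.filter (fun y => decide (χ (d * y) = c)) ys).length =
            (List.filter (fun y => decide (χ (d * y) = c)) ys).length +
              if χ (d * y) = c then 1 else 0 := by
          intro c
          by_cases h : χ (d * y) = c <;> simp [h]
        simp_rw [this]
        rw [Finset.sum_add_distrib]
        simp
    have h2 : ∑ c : Fin r, (ys.filter (fun y => χ (d * y) = c)).length ≤ ∑ c : Fin r, M :=
      Finset.sum_le_sum fun c _ => (hcon c).le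
    simp at h2
    lia
  obtain ⟨c, hc⟩ := this
  refine ⟨(ys.filter (fun y => χ (d * y) = c)).take M, by simpa using hc,
    Lvl_sublist h0 ((List.take_sublist _ _).trans List.filter_sublist) hlvl, ?_⟩
  have : ∀ y ∈ (ys.filter (fun y => χ (d * y) = c)).take M, χ (d * y) = c := by
    intro y hy
    have := List.mem_of_mem_take hy
    simpa using (List.mem_filter.1 this).2
  intro y hy y' hy'
  rw [this y hy, this y' hy']

theorem FComb_sum {F : Set S} : ∀ (ys : List S) (a : ℕ → S), (∀ i, a i ∈ F) →
    ∑ i ∈ Finset.range ys.length, a i * ys.getD i 0 ∈ FComb F ys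
  | [], a, _ => by simp [FComb]
  | y :: ys, a, h => by
    rw [List.length_cons, Finset.sum_range_succ']
    refine ⟨a 0, h 0, _, FComb_sum ys (fun i => a (i + 1)) (fun i => h _), ?_⟩
    simp [add_comm]

theorem Lvl_sum {F : Set S} {d : S} {r : ℕ} {χ : S → Fin r} :
    ∀ (ys : List S) (_ : Lvl F d χ ys) (s : ℕ) (_ : s < ys.length) (a : ℕ → S)
      (_ : ∀ i < s, a i = 0) (_ : a s = d) (_ : ∀ i, s < i → a i ∈ F),
      ∑ i ∈ Finset.range ys.length, a i * ys.getD i 0 ≠ 0 ∧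
      χ (∑ i ∈ Finset.range ys.length, a i * ys.getD i 0) = χ (d * ys.getD s 0)
  | [], _, s, hs, _, _, _, _ => by simp at hs
  | y :: ys, hl, 0, _, a, _, h2, h3 => by
    rw [List.length_cons, Finset.sum_range_succ']
    have := hl.1 _ (FComb_sum ys (fun i => a (i + 1)) (fun i => h3 _ (Nat.succ_pos i)))
    simpa [h2, add_comm] using this
  | y :: ys, hl, s + 1, hs, a, h1, h2, h3 => by
    rw [List.length_cons, Finset.sum_range_succ']
    have := Lvl_sum ys hl.2 s (by simpa using hs) (fun i => a (i + 1))
      (fun i hi => h1 _ (by lia)) h2 (fun i hi => h3 _ (by lia))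
    simpa [h1 0 (Nat.succ_pos s)] using this

/-- Sufficiency of the columns condition over an infinite domain. -/
theorem pr_of_kernel_vectors [IsDomain S] [Infinite S] {R : Type*} [CommRing R] [Algebra R S]
    {k l : ℕ} (A : Matrix (Fin k) (Fin l) R) (hl : 0 < l) (M : ℕ) (f : Fin l → ℕ)
    (hf : ∀ j, f j < M) (d : S) (hd : d ≠ 0) (w : ℕ → Fin l → S)
    (hw : ∀ t < M, ∀ i, ∑ j, A i j • w t j = 0)
    (hw1 : ∀ t j, f j = t → w t j = d) (hw2 : ∀ t j, t < f j → w t j = 0)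
    (hw3 : ∀ t j, M ≤ t → w t j = 0) :
    IsPRAll A S := by
  intro r _ χ
  let F : Set S := insert 0 ((fun q : Fin M × Fin l => w q.1 q.2) '' Set.univ)
  have hF : F.Finite := (Set.finite_univ.image _).insert 0
  have hwF : ∀ t j, w t j ∈ F := by
    intro t j
    by_cases ht : t < M
    · exact Or.inr ⟨(⟨t, ht⟩, j), trivial, rfl⟩
    · exact Or.inl (hw3 t j (not_lt.1 ht))
  obtain ⟨ys, hlen, hlvl, hmono⟩ := deuber_mono hF (Set.mem_insert _ _) hd r M χ
  have key := fun j => Lvl_sum ys hlvl (f j) (hlen ▸ hf j) (fun t => w t j)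
    (fun i hi => hw2 i j hi) (hw1 _ j rfl) (fun i _ => hwF i j)
  refine ⟨fun j => ∑ i ∈ Finset.range ys.length, w i j * ys.getD i 0, ?_, ?_, ?_⟩
  · intro h
    exact (key ⟨0, hl⟩).1 (congrFun h ⟨0, hl⟩)
  · intro i
    simp_rw [Finset.smul_sum]
    rw [Finset.sum_comm]
    refine Finset.sum_eq_zero fun t ht => ?_
    have := hw t (hlen ▸ Finset.mem_range.1 ht) i
    calc ∑ j, A i j • (w t j * ys.getD t 0) = (∑ j, A i j • w t j) * ys.getD t 0 := by
          rw [Finset.sum_mul]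
          exact Finset.sum_congr rfl fun j _ => (smul_mul_assoc _ _ _).symm
      _ = 0 := by rw [this, zero_mul]
  · intro j j'
    simp only
    rw [(key j).2, (key j').2]
    have hmem : ∀ j, ys.getD (f j) 0 ∈ ys := by
      intro j
      rw [List.getD_eq_getElem _ _ (hlen ▸ hf j)]
      exact List.getElem_mem _
    exact hmono _ (hmem j) _ (hmem j')

end Deuber

section Necessity

universe u

theorem IsPRAll.finite_colour {S : Type*} [CommRing S] {k l : ℕ} {A : Matrix (Fin k) (Fin l) S}
    {M : Type*} [AddCommGroup M] [Module S M] (h : IsPRAll A M) {C : Type*} [Finite C]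
    (χ : M → C) : ∃ m : Fin l → M, m ≠ 0 ∧
      (∀ i, ∑ j, A i j • m j = 0) ∧ ∀ j j', χ (m j) = χ (m j') := by
  have : Nonempty C := ⟨χ 0⟩
  obtain ⟨n, ⟨e⟩⟩ := Finite.exists_equiv_fin C
  have hn : 1 ≤ n := by
    rcases Nat.eq_zero_or_pos n with rfl | h
    · exact (e (χ 0)).elim0
    · exact h
  obtain ⟨m, h1, h2, h3⟩ := h n hn (fun x => e (χ x))
  exact ⟨m, h1, h2, fun j j' => e.injective (h3 j j')⟩

theorem isJacobsonRing_int : IsJacobsonRing ℤ := by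
  rw [isJacobsonRing_iff_prime_eq]
  intro P hP
  by_cases hb : P = ⊥
  · subst hb
    refine le_antisymm (fun x hx => ?_) Ideal.le_jacobson
    rw [Ideal.mem_jacobson_bot] at hx
    have h1 := Int.isUnit_iff.1 (hx x)
    rw [Ideal.mem_bot]
    rcases h1 with h1 | h1 <;> nlinarith
  · have : P.IsMaximal := IsPrime.to_maximal_ideal hb
    exact Ideal.jacobson_eq_self_of_isMaximal

theorem finite_field_of_finiteType_int (k : Type*) [Field k] [Algebra ℤ k]
    [Algebra.FiniteType ℤ k] : Finite k := by
  obtain rfl : ‹Algebra ℤ k› = Ring.toIntAlgebra k := Subsingleton.elim _ _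
  have := isJacobsonRing_int
  have : Module.Finite ℤ k := finite_of_finite_type_of_isJacobsonRing ℤ k
  rcases CharP.exists k with ⟨p, hp⟩
  rcases CharP.char_is_prime_or_zero k p with h | h
  · have : Fact p.Prime := ⟨h⟩
    have : Module.IsTorsion ℤ k := by
      intro x
      refine ⟨⟨p, by simpa using h.ne_zero⟩, ?_⟩
      change (p : ℤ) • x = 0
      rw [zsmul_eq_mul]
      simp
    exact Module.finite_of_fg_torsion k this
  · subst h
    have : CharZero k := CharP.charP_to_charZero k
    exfalso
    have : Algebra.IsIntegral ℤ k := Algebra.IsIntegral.of_finite ℤ k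
    have : IsField ℤ := isField_of_isIntegral_of_isField (R := ℤ) (S := k)
      (by rw [RingHom.ext_int (algebraMap ℤ k) (Int.castRingHom k)]; exact Int.cast_injective) (Field.toIsField k)
    exact Int.not_isField this

/-- The valuation-theoretic data used for colouring a field. -/
theorem exists_place {K : Type u} [Field K] (T : Set K) (hT : T.Finite) :
    ∃ (S0 : Subring K) (V : ValuationSubring K) (hV : S0 ≤ V.toSubring) (k : Type u) (_ : Field k)
      (_ : Algebra k (IsLocalRing.ResidueField V)) (π : S0 →+* k), T ⊆ S0 ∧ Finite k ∧
      ∀ s : S0, algebraMap k (IsLocalRing.ResidueField V) (π s) =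
        IsLocalRing.residue V ⟨s, hV s.2⟩ := by
  let S1 : Subalgebra ℤ K := Algebra.adjoin ℤ T
  have : Algebra.FiniteType ℤ S1 := Algebra.FiniteType.adjoin_of_finite hT
  let S0 : Subring K := S1.toSubring
  have : Algebra.FiniteType ℤ S0 := ‹Algebra.FiniteType ℤ S1›
  obtain ⟨m, hm⟩ := Ideal.exists_maximal S0
  obtain ⟨V, hV, hmV⟩ := Ideal.image_subset_nonunits_valuationSubring m hm.ne_top
  let ρ : S0 →+* V := Subring.inclusion hV
  have hker : ∀ s ∈ m, (IsLocalRing.residue V).comp ρ s = 0 := by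
    intro s hs
    have : (s : K) ∈ V.nonunits := hmV ⟨s, hs, rfl⟩
    rw [RingHom.comp_apply, IsLocalRing.residue_eq_zero_iff, IsLocalRing.mem_maximalIdeal]
    rw [ValuationSubring.mem_nonunits_iff_exists_mem_maximalIdeal] at this
    obtain ⟨h1, h2⟩ := this
    exact h2
  let ψ : S0 ⧸ m →+* IsLocalRing.ResidueField V := Ideal.Quotient.lift m _ hker
  let : Field (S0 ⧸ m) := Ideal.Quotient.field m
  have : Algebra.FiniteType ℤ (S0 ⧸ m) :=
    Algebra.FiniteType.of_surjective (Ideal.Quotient.mkₐ ℤ m) (Ideal.Quotient.mkₐ_surjective ℤ m)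
  have hfin : Finite (S0 ⧸ m) := finite_field_of_finiteType_int (S0 ⧸ m)
  refine ⟨S0, V, hV, S0 ⧸ m, inferInstance, ψ.toAlgebra, Ideal.Quotient.mk m,
    fun t ht => Algebra.subset_adjoin ht, hfin, fun s => rfl⟩

/-- Necessity of the columns condition over a field. -/
theorem columns_of_pr_field {R : Type*} [CommRing R] {K : Type u} [Field K] [Algebra R K]
    {k l : ℕ} (A : Matrix (Fin k) (Fin l) R) (h : IsPRAll A K) :
    ∃ (L : Type u) (_ : LinearOrder L) (f : Fin l → L), ∀ j0,
      (∑ j with f j = f j0, fun i => algebraMap R K (A i j)) ∈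
        Submodule.span K ((fun j (i : Fin k) => algebraMap R K (A i j)) '' {j | f j < f j0}) := by
  classical
  let c : Fin l → Fin k → K := fun j i => algebraMap R K (A i j)
  have hφ : ∀ I J : Finset (Fin l), ∃ φ : Fin k → K,
      (∑ j ∈ I, c j) ∉ Submodule.span K (c '' (J : Set (Fin l))) →
      (∀ j ∈ J, ∑ i, φ i * c j i = 0) ∧ ∑ j ∈ I, ∑ i, φ i * c j i = 1 := by
    intro I J
    by_cases hm : (∑ j ∈ I, c j) ∈ Submodule.span K (c '' (J : Set (Fin l)))
    · exact ⟨0, fun h => absurd hm h⟩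
    · obtain ⟨g, hg1, hg2⟩ := Submodule.exists_le_ker_of_notMem hm
      have hgs : ∀ v : Fin k → K, g v = ∑ i, g (Pi.single i 1) * v i := by
        intro v
        conv_lhs => rw [pi_eq_sum_univ' v]
        rw [map_sum]
        refine Finset.sum_congr rfl fun i _ => ?_
        rw [map_smul, smul_eq_mul, mul_comm]
      refine ⟨fun i => (g (∑ j ∈ I, c j))⁻¹ * g (Pi.single i 1), fun _ => ⟨fun j hj => ?_, ?_⟩⟩
      · have : g (c j) = 0 := hg2 (Submodule.subset_span ⟨j, hj, rfl⟩)
        simp_rw [mul_assoc]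
        rw [← Finset.mul_sum, ← hgs, this, mul_zero]
      · simp_rw [mul_assoc]
        simp_rw [← Finset.mul_sum, ← hgs]
        rw [← map_sum]
        exact inv_mul_cancel₀ hg1
  choose φ hφ using hφ
  obtain ⟨S0, V, hV, F, _, _, π, hT, hF, hπ⟩ := exists_place
    (Set.range (fun q : Fin l × Fin k => c q.1 q.2) ∪
      Set.range (fun q : Finset (Fin l) × Finset (Fin l) × Fin k => φ q.1 q.2.1 q.2.2))
    ((Set.finite_range _).union (Set.finite_range _))
  have hc0 : ∀ j i, c j i ∈ S0 := fun j i => hT (Or.inl ⟨(j, i), rfl⟩)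
  have hφ0 : ∀ I J i, φ I J i ∈ S0 := fun I J i => hT (Or.inr ⟨(I, J, i), rfl⟩)
  let κ := IsLocalRing.ResidueField V
  let b := Module.Basis.ofVectorSpace F κ
  let : LinearOrder (Module.Basis.ofVectorSpaceIndex F κ) := linearOrderOfSTO WellOrderingRel
  let Γ := V.ValueGroup
  have htt : ∀ γ : Γ, ∃ x, V.valuation x = γ := V.valuation_surjective
  choose tt htt using htt
  let res : K → κ := fun x => if hx : x ∈ V then IsLocalRing.residue V ⟨x, hx⟩ else 0
  let ac : K → κ := fun x => res (x / tt (V.valuation x))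
  have htt0 : ∀ x : K, x ≠ 0 → tt (V.valuation x) ≠ 0 := by
    intro x hx h0
    have := htt (V.valuation x)
    rw [h0, map_zero] at this
    exact hx ((map_eq_zero _).1 this.symm)
  have hac : ∀ x : K, x ≠ 0 → ac x ≠ 0 := by
    intro x hx
    have h1 : V.valuation (x / tt (V.valuation x)) = 1 := by
      rw [map_div₀, htt, div_self ((map_ne_zero _).2 hx)]
    have hmem : x / tt (V.valuation x) ∈ V := (V.valuation_le_one_iff _).1 h1.le
    simp only [ac, res, dif_pos hmem]
    rw [Ne, IsLocalRing.residue_eq_zero_iff, IsLocalRing.mem_maximalIdeal, mem_nonunits_iff,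
      not_not, ValuationSubring.valuation_eq_one_iff]
    exact h1
  let supp : K → Finset (Module.Basis.ofVectorSpaceIndex F κ) := fun x => (b.repr (ac x)).support
  have hsupp : ∀ x : K, x ≠ 0 → (supp x).Nonempty := by
    intro x hx
    rw [Finsupp.support_nonempty_iff]
    simpa using hac x hx
  let χ : K → F := fun x => if hx : x = 0 then 0 else b.repr (ac x) ((supp x).min' (hsupp x hx))
  have hχ : ∀ x (hx : x ≠ 0), χ x = b.repr (ac x) ((supp x).min' (hsupp x hx)) := by
    intro x hx
    simp only [χ, dif_neg hx]
  have hχ0 : ∀ x, x ≠ 0 → χ x ≠ 0 := by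
    intro x hx
    rw [hχ x hx]
    exact Finsupp.mem_support_iff.1 (Finset.min'_mem _ (hsupp x hx))
  obtain ⟨x, hx0, hAx, hmono⟩ := h.finite_colour χ
  have hx : ∀ j, x j ≠ 0 := by
    obtain ⟨j0, hj0⟩ : ∃ j, x j ≠ 0 := by
      by_contra! hcon
      exact hx0 (funext hcon)
    intro j hj
    apply hχ0 _ hj0
    rw [hmono j0 j, hj]
    simp [χ]
  let ix : Fin l → Module.Basis.ofVectorSpaceIndex F κ := fun j => (supp (x j)).min' (hsupp _ (hx j))
  let f : Fin l → Lex (Γᵒᵈ × Module.Basis.ofVectorSpaceIndex F κ) :=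
    fun j => toLex (OrderDual.toDual (V.valuation (x j)), ix j)
  refine ⟨Lex (Γᵒᵈ × Module.Basis.ofVectorSpaceIndex F κ), inferInstance, f, fun j0 => ?_⟩
  by_contra hcon
  let I : Finset (Fin l) := Finset.univ.filter (fun j => f j = f j0)
  let J : Finset (Fin l) := Finset.univ.filter (fun j => f j < f j0)
  have hJ : (J : Set (Fin l)) = {j | f j < f j0} := by
    ext j
    simp [J]
  obtain ⟨h1, h2⟩ := hφ I J (by rw [hJ]; convert hcon)
  let a : Fin l → S0 := fun j => ⟨∑ i, φ I J i * c j i,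
    S0.sum_mem fun i _ => S0.mul_mem (hφ0 I J i) (hc0 j i)⟩
  have ha1 : ∀ j ∈ J, a j = 0 := fun j hj => Subtype.ext (h1 j hj)
  have ha2 : ∑ j ∈ I, a j = 1 := by
    apply Subtype.ext
    rw [AddSubmonoidClass.coe_finsetSum]
    exact h2
  have ha3 : ∑ j, (a j : K) * x j = 0 := by
    have : ∀ i, ∑ j, c j i * x j = 0 := by
      intro i
      rw [← hAx i]
      exact Finset.sum_congr rfl fun j _ => (Algebra.smul_def _ _).symm
    calc ∑ j, (a j : K) * x j = ∑ j, ∑ i, φ I J i * (c j i * x j) := by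
          refine Finset.sum_congr rfl fun j _ => ?_
          simp only [a]
          rw [Finset.sum_mul]
          exact Finset.sum_congr rfl fun i _ => by ring
      _ = ∑ i, φ I J i * ∑ j, c j i * x j := by
          rw [Finset.sum_comm]
          simp_rw [Finset.mul_sum]
      _ = 0 := by simp [this]
  let t := tt (V.valuation (x j0))
  have ht : V.valuation t = V.valuation (x j0) := htt _
  have ht0 : t ≠ 0 := htt0 _ (hx j0)
  have hvt0 : V.valuation t ≠ 0 := (map_ne_zero _).2 ht0
  have hlt : ∀ j, f j < f j0 ↔ (V.valuation (x j0) < V.valuation (x j) ∨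
      V.valuation (x j) = V.valuation (x j0) ∧ ix j < ix j0) := by
    intro j
    simp only [f, Prod.Lex.toLex_lt_toLex]
    rfl
  have hzmem : ∀ j, (if j ∈ J then 0 else x j / t) ∈ V := by
    intro j
    split_ifs with hj
    · exact V.zero_mem
    · rw [← V.valuation_le_one_iff, map_div₀, ht]
      have : ¬ f j < f j0 := by simpa [J] using hj
      rw [hlt] at this
      push Not at this
      exact div_le_one_of_le₀ this.1 zero_le
  let z : Fin l → V := fun j => ⟨_, hzmem j⟩
  let co : V → F := fun y => b.repr (IsLocalRing.residue V y) (ix j0)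
  have hsum : ∑ j, (⟨a j, hV (a j).2⟩ : V) * z j = 0 := by
    apply Subtype.ext
    rw [AddSubmonoidClass.coe_finsetSum]
    have : ∀ j, (((⟨a j, hV (a j).2⟩ : V) * z j : V) : K) = (a j : K) * x j / t := by
      intro j
      change (a j : K) * (if j ∈ J then 0 else x j / t) = _
      split_ifs with hj
      · rw [ha1 j hj]; simp
      · rw [mul_div_assoc]
    simp_rw [this]
    rw [← Finset.sum_div, ha3, zero_div]
    rfl
  have hco : ∑ j, π (a j) * co (z j) = 0 := by
    have h3 : co (∑ j, (⟨a j, hV (a j).2⟩ : V) * z j) = ∑ j, π (a j) * co (z j) := by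
      simp only [co]
      rw [map_sum, map_sum, Finsupp.finsetSum_apply]
      refine Finset.sum_congr rfl fun j _ => ?_
      rw [map_mul, ← hπ, ← Algebra.smul_def, map_smul, Finsupp.smul_apply, smul_eq_mul]
    rw [← h3, hsum]
    simp [co]
  have hz : ∀ j, π (a j) * co (z j) = if j ∈ I then π (a j) * χ (x j0) else 0 := by
    intro j
    by_cases hjJ : j ∈ J
    · rw [ha1 j hjJ]; simp
    have hjf : ¬ f j < f j0 := by simpa [J] using hjJ
    have hzj : (z j : K) = x j / t := by simp [z, hjJ]
    have hres : V.valuation (x j) = V.valuation (x j0) → IsLocalRing.residue V (z j) = ac (x j) := by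
      intro hv
      have e : x j / tt (V.valuation (x j)) = z j := by rw [hzj, hv]
      simp only [ac, res]
      rw [dif_pos (by rw [e]; exact (z j).2)]
      congr 1
      exact Subtype.ext e.symm
    split_ifs with hjI
    · have hfe : f j = f j0 := by simpa [I] using hjI
      have hfe' := congrArg ofLex hfe
      simp only [f, ofLex_toLex, Prod.mk.injEq] at hfe'
      have hv : V.valuation (x j) = V.valuation (x j0) := OrderDual.toDual.injective hfe'.1
      congr 1
      simp only [co]
      rw [hres hv, ← hfe'.2, hmono j0 j, hχ _ (hx j)]
    · have hfne : f j ≠ f j0 := by simpa [I] using hjI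
      have hgt : f j0 < f j := lt_of_le_of_ne (not_lt.1 hjf) hfne.symm
      have hgt' : V.valuation (x j) < V.valuation (x j0) ∨
          V.valuation (x j0) = V.valuation (x j) ∧ ix j0 < ix j := by
        simp only [f, Prod.Lex.toLex_lt_toLex] at hgt
        exact hgt
      suffices co (z j) = 0 by rw [this, mul_zero]
      simp only [co]
      rcases hgt' with hv | ⟨hv, hi⟩
      · have : IsLocalRing.residue V (z j) = 0 := by
          rw [IsLocalRing.residue_eq_zero_iff, ValuationSubring.valuation_lt_one_iff, hzj,
            map_div₀, ht]
          exact (div_lt_one₀ (zero_lt_iff.2 ((map_ne_zero _).2 (hx j0)))).2 hv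
        rw [this]; simp
      · rw [hres hv.symm]
        by_contra hne
        have hmem : ix j0 ∈ supp (x j) := Finsupp.mem_support_iff.2 hne
        exact absurd (Finset.min'_le _ _ hmem) (not_le.2 hi)
  simp_rw [hz] at hco
  rw [← Finset.sum_filter, Finset.filter_univ_mem, ← Finset.sum_mul, ← map_sum, ha2, map_one,
    one_mul] at hco
  exact hχ0 _ (hx j0) hco

end Necessity

section Devissage

universe u

theorem coprimary_base {R : Type u} [CommRing R] (p : Ideal R) [p.IsPrime]
    (N : Type u) [AddCommGroup N] [Module R N] [Module.Finite R N]
    (h1 : ∀ a ∈ p, ∀ x : N, a • x = 0) (h2 : ∀ a ∉ p, ∀ x : N, a • x = 0 → x = 0) :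
    ∃ (n : ℕ) (φ : N →ₗ[R] (Fin n → FractionRing (R ⧸ p))), Function.Injective φ := by
  have htor : Module.IsTorsionBySet R N p := fun x a => h1 a a.2 x
  let _ : Module (R ⧸ p) N := htor.module
  have hst : IsScalarTower R (R ⧸ p) N := htor.isScalarTower
  have : Module.Finite (R ⧸ p) N := Module.Finite.of_restrictScalars_finite R (R ⧸ p) N
  let K := FractionRing (R ⧸ p)
  let W := LocalizedModule (nonZeroDivisors (R ⧸ p)) N
  have : Module.Finite K W :=
    inferInstanceAs (Module.Finite (Localization (nonZeroDivisors (R ⧸ p)))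
      (LocalizedModule (nonZeroDivisors (R ⧸ p)) N))
  let e : W ≃ₗ[K] (Fin (Module.finrank K W) → K) := (Module.finBasis K W).equivFun
  let ι : N →ₗ[R ⧸ p] W := LocalizedModule.mkLinearMap (nonZeroDivisors (R ⧸ p)) N
  have hι : Function.Injective ι := by
    rw [← LinearMap.ker_eq_bot, LinearMap.ker_eq_bot']
    intro x hx
    have hx' : LocalizedModule.mk x (1 : nonZeroDivisors (R ⧸ p)) = 0 := hx
    rw [← LocalizedModule.zero_mk 1, LocalizedModule.mk_eq] at hx'
    obtain ⟨c, hc⟩ := hx'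
    obtain ⟨a, ha⟩ := Ideal.Quotient.mk_surjective (c : R ⧸ p)
    have hc' : (c : R ⧸ p) • x = 0 := by simpa [Submonoid.smul_def] using hc
    rw [← ha] at hc'
    have hane : a ∉ p := by
      intro hap
      rw [Ideal.Quotient.eq_zero_iff_mem.2 hap] at ha
      exact nonZeroDivisors.coe_ne_zero c ha.symm
    exact h2 a hane x hc'
  refine ⟨Module.finrank K W,
    { toFun := fun x => e (ι x), map_add' := fun x y => by simp, map_smul' := fun r x => ?_ },
    e.injective.comp hι⟩
  have e1 : r • x = (Ideal.Quotient.mk p r) • x := rfl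
  rw [e1, map_smul]
  have e2 : (Ideal.Quotient.mk p r) • ι x = (algebraMap (R ⧸ p) K (Ideal.Quotient.mk p r)) • ι x :=
    (IsScalarTower.algebraMap_smul K (Ideal.Quotient.mk p r) (ι x)).symm
  rw [e2, map_smul]
  ext i
  simp only [Pi.smul_apply, RingHom.id_apply, smul_eq_mul]
  rw [Algebra.smul_def]
  rfl

theorem dev_inj {R : Type u} [CommRing R]
  (P : ∀ (M : Type u) [AddCommGroup M] [Module R M], Prop)
  (hsub : ∀ (M : Type u) [AddCommGroup M] [Module R M], Subsingleton M → P M)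
  (hext : ∀ (M N : Type u) [AddCommGroup M] [Module R M] [AddCommGroup N] [Module R N]
    (φ : M →ₗ[R] N), P N → P (LinearMap.ker φ) → P M)
    (M N : Type u) [AddCommGroup M] [Module R M] [AddCommGroup N] [Module R N]
    (φ : M →ₗ[R] N) (hφ : Function.Injective φ) (h : P N) : P M := by
  refine hext M N φ h (hsub _ ?_)
  rw [LinearMap.ker_eq_bot.2 hφ]
  infer_instance

theorem dev_pi {R : Type u} [CommRing R]
  (P : ∀ (M : Type u) [AddCommGroup M] [Module R M], Prop)
  (hsub : ∀ (M : Type u) [AddCommGroup M] [Module R M], Subsingleton M → P M)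
  (hext : ∀ (M N : Type u) [AddCommGroup M] [Module R M] [AddCommGroup N] [Module R N]
    (φ : M →ₗ[R] N), P N → P (LinearMap.ker φ) → P M)
    (N : Type u) [AddCommGroup N] [Module R N] (h : P N) (n : ℕ) : P (Fin n → N) := by
  induction n with
  | zero => exact hsub _ inferInstance
  | succ n ih =>
    refine hext _ N (LinearMap.proj 0) h ?_
    refine dev_inj P hsub hext _ (Fin n → N)
      ((LinearMap.funLeft R N Fin.succ).comp (Submodule.subtype _)) ?_ ih
    rintro ⟨x, hx⟩ ⟨y, hy⟩ hxy
    apply Subtype.ext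
    funext i
    refine Fin.cases ?_ (fun i => ?_) i
    · have hx' : x 0 = 0 := hx
      have hy' : y 0 = 0 := hy
      exact hx'.trans hy'.symm
    · exact congrFun hxy i

theorem dev_coprimary {R : Type u} [CommRing R] [IsNoetherianRing R]
  (P : ∀ (M : Type u) [AddCommGroup M] [Module R M], Prop)
  (hsub : ∀ (M : Type u) [AddCommGroup M] [Module R M], Subsingleton M → P M)
  (hext : ∀ (M N : Type u) [AddCommGroup M] [Module R M] [AddCommGroup N] [Module R N]
    (φ : M →ₗ[R] N), P N → P (LinearMap.ker φ) → P M)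
    (p : Ideal R) [p.IsPrime] (hp : P (FractionRing (R ⧸ p))) (n : ℕ) :
    ∀ (M : Type u) [AddCommGroup M] [Module R M] [Module.Finite R M]
      (_ : ∀ a ∈ p ^ n, ∀ x : M, a • x = 0) (_ : ∀ a ∉ p, ∀ x : M, a • x = 0 → x = 0), P M := by
  induction n with
  | zero =>
    intro M _ _ _ h1 h2
    refine hsub M ⟨fun x y => ?_⟩
    have := fun x : M => h1 1 (by simp) x
    simp only [one_smul] at this
    rw [this x, this y]
  | succ n ih =>
    intro M _ _ _ h1 h2
    let M' : Submodule R M := p • ⊤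
    have hM' : P M' := by
      refine ih M' ?_ ?_
      · rintro a ha ⟨y, hy⟩
        apply Subtype.ext
        change a • y = 0
        refine Submodule.smul_induction_on hy (fun b hb x _ => ?_) (fun x y hx hy => ?_)
        · rw [smul_smul]
          exact h1 _ (by rw [pow_succ]; exact Ideal.mul_mem_mul ha hb) x
        · rw [smul_add, hx, hy, add_zero]
      · rintro a ha ⟨y, hy⟩ h
        exact Subtype.ext (h2 a ha y (congrArg Subtype.val h))
    obtain ⟨s, g, hg⟩ := Submodule.fg_iff_exists_fin_generating_family.1
      (IsNoetherian.noetherian p)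
    have hgp : ∀ i, g i ∈ p := fun i => hg ▸ Submodule.subset_span ⟨i, rfl⟩
    let φ : M →ₗ[R] (Fin s → M') := LinearMap.pi fun i =>
      (LinearMap.lsmul R M (g i)).codRestrict M'
        (fun x => Submodule.smul_mem_smul (hgp i) Submodule.mem_top)
    refine hext M _ φ (dev_pi P hsub hext M' hM' s) ?_
    obtain ⟨q, ψ, hψ⟩ := coprimary_base p (LinearMap.ker φ) (by
      rintro a ha ⟨x, hx⟩
      apply Subtype.ext
      change a • x = 0
      rw [← hg] at ha
      refine Submodule.span_induction ?_ ?_ ?_ ?_ ha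
      · rintro _ ⟨i, rfl⟩
        have : φ x = 0 := hx
        exact congrArg Subtype.val (congrFun this i)
      · simp
      · intro a b _ _ ha hb
        rw [add_smul, ha, hb, add_zero]
      · intro r a _ ha
        rw [smul_eq_mul, mul_smul, ha, smul_zero]) (by
      rintro a ha ⟨y, hy⟩ h
      exact Subtype.ext (h2 a ha y (congrArg Subtype.val h)))
    exact dev_inj P hsub hext _ _ ψ hψ (dev_pi P hsub hext _ hp q)

theorem dev_inf {R : Type u} [CommRing R]
  (P : ∀ (M : Type u) [AddCommGroup M] [Module R M], Prop)
  (hsub : ∀ (M : Type u) [AddCommGroup M] [Module R M], Subsingleton M → P M)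
  (hext : ∀ (M N : Type u) [AddCommGroup M] [Module R M] [AddCommGroup N] [Module R N]
    (φ : M →ₗ[R] N), P N → P (LinearMap.ker φ) → P M)
    (M : Type u) [AddCommGroup M] [Module R M] (t : Finset (Submodule R M))
    (h : ∀ Q ∈ t, P (M ⧸ Q)) : P (M ⧸ t.inf id) := by
  classical
  induction t using Finset.induction_on with
  | empty =>
    refine hsub _ ?_
    rw [Finset.inf_empty]
    infer_instance
  | insert Q t _ ih =>
    have ih := ih fun Q' hQ' => h Q' (Finset.mem_insert_of_mem hQ')
    rw [Finset.inf_insert]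
    refine hext _ (M ⧸ Q) (Submodule.factor inf_le_left) (h Q (Finset.mem_insert_self _ _)) ?_
    refine dev_inj P hsub hext _ _ ((Submodule.factor inf_le_right).comp (Submodule.subtype _))
      ?_ ih
    rw [← LinearMap.ker_eq_bot, LinearMap.ker_eq_bot']
    rintro ⟨x, hx⟩ hx'
    obtain ⟨y, rfl⟩ := Submodule.mkQ_surjective _ x
    apply Subtype.ext
    have h1 : Submodule.Quotient.mk (p := Q) y = 0 := hx
    have h2 : Submodule.Quotient.mk (p := t.inf id) y = 0 := hx'
    rw [Submodule.Quotient.mk_eq_zero] at h1 h2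
    change Submodule.Quotient.mk y = 0
    rw [Submodule.Quotient.mk_eq_zero]
    exact ⟨h1, h2⟩

theorem devissage {R : Type u} [CommRing R] [IsNoetherianRing R]
  (P : ∀ (M : Type u) [AddCommGroup M] [Module R M], Prop)
  (hsub : ∀ (M : Type u) [AddCommGroup M] [Module R M], Subsingleton M → P M)
  (hext : ∀ (M N : Type u) [AddCommGroup M] [Module R M] [AddCommGroup N] [Module R N]
    (φ : M →ₗ[R] N), P N → P (LinearMap.ker φ) → P M)
    (M : Type u) [AddCommGroup M] [Module R M] [Module.Finite R M]
    (h : ∀ (p : Ideal R) [p.IsPrime], IsAssociatedPrime p M → P (FractionRing (R ⧸ p))) : P M := by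
  obtain ⟨t, ht⟩ := Submodule.IsLasker.exists_isMinimalPrimaryDecomposition (Submodule.isLasker R M) ⊥
  have hinf := ht.inf_eq
  refine dev_inj P hsub hext M (M ⧸ t.inf id) (Submodule.mkQ _) ?_ (dev_inf P hsub hext M t ?_)
  · rw [← LinearMap.ker_eq_bot, Submodule.ker_mkQ, hinf]
  · intro Q hQ
    have hprim := ht.primary hQ
    have hass : IsAssociatedPrime (Q.colon Set.univ).radical M := ht.mem_associatedPrimes hQ
    have hprime := hprim.isPrime_radical_colon
    obtain ⟨n, hn⟩ := Ideal.exists_radical_pow_le_of_fg (Q.colon Set.univ)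
      (IsNoetherian.noetherian _)
    refine dev_coprimary P hsub hext (Q.colon Set.univ).radical (h _ hass) n (M ⧸ Q) ?_ ?_
    · intro a ha x
      obtain ⟨y, rfl⟩ := Submodule.mkQ_surjective _ x
      rw [← map_smul, Submodule.mkQ_apply, Submodule.Quotient.mk_eq_zero]
      exact Submodule.mem_colon.1 (hn ha) y trivial
    · intro a ha x hx
      obtain ⟨y, rfl⟩ := Submodule.mkQ_surjective _ x
      rw [← map_smul, Submodule.mkQ_apply, Submodule.Quotient.mk_eq_zero] at hx
      rw [Submodule.mkQ_apply, Submodule.Quotient.mk_eq_zero]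
      exact (hprim.mem_or_mem hx).resolve_right ha

end Devissage

section Applications

universe u

theorem IsPRAll.exists_associatedPrime {R : Type u} [CommRing R] [IsNoetherianRing R] {k l : ℕ}
    {A : Matrix (Fin k) (Fin l) R} (h : IsPRAll A R) :
    ∃ (p : Ideal R) (_ : p.IsPrime), IsAssociatedPrime p R ∧ IsPRAll A (FractionRing (R ⧸ p)) := by
  classical
  by_contra! hcon
  refine devissage (fun M _ _ => ¬ IsPRAll A M) ?_ ?_ R (fun p hp hass => hcon p hp hass) h
  · intro M _ _ hM hPR
    obtain ⟨m, hm, -⟩ := hPR 1 le_rfl (fun _ => 0)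
    exact hm (Subsingleton.elim _ _)
  · intro M N _ _ _ _ φ hN hK hM
    simp only [IsPRAll, IsPR] at hN hK
    push Not at hN hK
    obtain ⟨r, -, χ, hχ⟩ := hN
    obtain ⟨s, -, η, hη⟩ := hK
    obtain ⟨m, hm0, hA, hmono⟩ := hM.finite_colour (C := Fin r × Fin s) (fun x =>
      (χ (φ x), if hx : x ∈ LinearMap.ker φ then η ⟨x, hx⟩ else η 0))
    by_cases hφ : (fun j => φ (m j)) = 0
    · have hk : ∀ j, m j ∈ LinearMap.ker φ := fun j => congrFun hφ j
      obtain ⟨j, j', hne⟩ := hη (fun j => ⟨m j, hk j⟩)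
        (fun h0 => hm0 (funext fun j => congrArg Subtype.val (congrFun h0 j)))
        (fun i => Subtype.ext (by
          rw [AddSubmonoidClass.coe_finsetSum]
          exact hA i))
      apply hne
      have := congrArg Prod.snd (hmono j j')
      simpa only [dif_pos (hk j), dif_pos (hk j')] using this
    · obtain ⟨j, j', hne⟩ := hχ _ hφ (fun i => by
        have := congrArg φ (hA i)
        simpa using this)
      exact hne (congrArg Prod.fst (hmono j j'))

theorem exists_infinite_associatedPrime {R : Type u} [CommRing R] [IsNoetherianRing R]
    (M : Type u) [AddCommGroup M] [Module R M] [Module.Finite R M] [Infinite M] :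
    ∃ (p : Ideal R) (_ : p.IsPrime), IsAssociatedPrime p M ∧ Infinite (R ⧸ p) := by
  by_contra! hcon
  have : Finite M := by
    refine devissage (R := R) (fun M _ _ => Finite M) ?_ ?_ M ?_
    · intro M _ _ _
      infer_instance
    · intro M N _ _ _ _ φ hN hK
      have : Finite (M ⧸ LinearMap.ker φ) :=
        Finite.of_injective _ (LinearMap.ker_eq_bot.1 (Submodule.ker_liftQ_eq_bot _ φ le_rfl le_rfl))
      exact (finite_iff_addSubgroup_quotient (LinearMap.ker φ).toAddSubgroup).2 ⟨hK, this⟩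
    · intro p hp hass
      have : Finite (R ⧸ p) := hcon p hp hass
      exact Finite.of_surjective (algebraMap (R ⧸ p) (FractionRing (R ⧸ p)))
        (IsFractionRing.surjective_iff_isField.2 (Finite.isField_of_domain (R ⧸ p)))
  exact not_finite M

theorem IsPRAll.of_injective {R : Type*} [CommRing R] {k l : ℕ} {A : Matrix (Fin k) (Fin l) R}
    {M N : Type*} [AddCommGroup M] [Module R M] [AddCommGroup N] [Module R N]
    (φ : M →ₗ[R] N) (hφ : Function.Injective φ) (h : IsPRAll A M) : IsPRAll A N := by
  intro r hr χ
  obtain ⟨m, h0, h1, h2⟩ := h r hr (fun x => χ (φ x))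
  refine ⟨fun j => φ (m j), fun h => h0 (funext fun j => ?_), fun i => ?_, h2⟩
  · exact hφ ((congrFun h j).trans (map_zero φ).symm)
  · have := congrArg φ (h1 i)
    simpa using this

end Applications
section Final

universe u

theorem ass_exists {R M : Type*} [CommRing R] [IsNoetherianRing R] [AddCommGroup M] [Module R M]
    {p : Ideal R} (h : IsAssociatedPrime p M) : ∃ x : M, ∀ a, a ∈ p ↔ a • x = 0 := by
  obtain ⟨-, x, hx⟩ := Submodule.isAssociatedPrime_iff.1 h
  refine ⟨x, fun a => ?_⟩
  rw [hx, Submodule.mem_colon_singleton, Submodule.mem_bot]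

theorem span_coeff {R : Type*} [CommRing R] {k l : ℕ} (v : Fin l → Fin k → R) (s : Set (Fin l))
    (x : Fin k → R) (hx : x ∈ Submodule.span R (v '' s)) :
    ∃ c : Fin l → R, (∀ j, j ∉ s → c j = 0) ∧ x = ∑ j, c j • v j := by
  classical
  refine Submodule.span_induction ?_ ?_ ?_ ?_ hx
  · rintro _ ⟨j, hj, rfl⟩
    refine ⟨Pi.single j 1, fun j' hj' => ?_, ?_⟩
    · exact Pi.single_eq_of_ne (by rintro rfl; exact hj' hj) _
    · simp [Pi.single_apply]
  · exact ⟨0, by simp, by simp⟩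
  · rintro x y _ _ ⟨c, hc, rfl⟩ ⟨c', hc', rfl⟩
    exact ⟨c + c', fun j hj => by simp [hc j hj, hc' j hj], by
      simp [add_smul, Finset.sum_add_distrib]⟩
  · rintro a x _ ⟨c, hc, rfl⟩
    exact ⟨a • c, fun j hj => by simp [hc j hj], by simp [Finset.smul_sum, mul_smul]⟩

/-- An embedding of `R ⧸ p` in `R` given by an element with annihilator `p`. -/
theorem pr_of_quotient {R : Type*} [CommRing R] {k l : ℕ} {A : Matrix (Fin k) (Fin l) R}
    {p : Ideal R} {x : R} (hx : ∀ a, a ∈ p ↔ a * x = 0) (h : IsPRAll A (R ⧸ p)) :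
    IsPRAll A R := by
  refine h.of_injective (Submodule.liftQ p (LinearMap.toSpanSingleton R R x) ?_) ?_
  · intro a ha
    exact (hx a).1 ha
  · rw [← LinearMap.ker_eq_bot]
    refine Submodule.ker_liftQ_eq_bot _ _ _ ?_
    intro a ha
    exact (hx a).2 ha

theorem pr_of_gcc {R : Type u} [CommRing R] [IsNoetherianRing R] {k l : ℕ}
    {A : Matrix (Fin k) (Fin l) R} (h : GenColumnsCondition A) : IsPRAll A R := by
  classical
  obtain ⟨m, I, d, hne, hdisj, hcov, hd, h0, hspan, hinf⟩ := h
  choose f hf using hcov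
  have hfI : ∀ j t, j ∈ I t ↔ f j = t := by
    intro j t
    constructor
    · intro h
      by_contra hh
      exact Finset.disjoint_left.1 (hdisj _ _ hh) (hf j) h
    · rintro rfl
      exact hf j
  have hl : 0 < l := by
    obtain ⟨j, -⟩ := hne 0
    exact j.pos
  rcases Nat.eq_zero_or_pos m with rfl | hm
  · intro r hr χ
    refine ⟨fun _ => d 0, fun h => hd 0 (congrFun h ⟨0, hl⟩), fun i => ?_, fun _ _ => rfl⟩
    rw [← h0 i, Finset.mul_sum]
    have : I 0 = Finset.univ := by
      ext j
      have hj : f j = 0 := Fin.ext (by have := (f j).isLt; simp only [Fin.val_zero]; omega)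
      simp [hfI, hj]
    rw [this]
    exact Finset.sum_congr rfl fun j _ => by rw [smul_eq_mul, mul_comm]
  · set D := ∏ t ∈ Finset.univ.filter (fun t => t ≠ 0), d t with hD
    have hinf := hinf hm
    -- stabilisation of annihilators
    let F : ℕ →o Ideal R :=
      { toFun := fun n => LinearMap.ker (LinearMap.toSpanSingleton R R (d 0 * D ^ n))
        monotone' := by
          intro a b hab x hx
          obtain ⟨c, rfl⟩ := Nat.exists_eq_add_of_le hab
          have hx' : x * (d 0 * D ^ a) = 0 := hx
          change x * (d 0 * D ^ (a + c)) = 0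
          rw [pow_add, ← mul_assoc (d 0), ← mul_assoc x, hx', zero_mul] }
    obtain ⟨n, hn⟩ := monotone_stabilizes_iff_noetherian.2 (inferInstanceAs (IsNoetherian R R)) F
    have hstab : ∀ x : R, x * (d 0 * D ^ (n + 1)) = 0 → x * (d 0 * D ^ n) = 0 := by
      intro x hx
      have : x ∈ F (n + 1) := hx
      rw [← hn (n + 1) (Nat.le_succ n)] at this
      exact this
    set e := d 0 * D ^ n with he
    have hInf : Infinite (Ideal.span {e} : Ideal R) := by
      refine Set.infinite_coe_iff.2 ((hinf n).mono ?_)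
      rintro _ ⟨r, rfl⟩
      exact Ideal.mul_mem_right _ _ (Ideal.subset_span rfl)
    obtain ⟨p, hp, hass, hpinf⟩ := exists_infinite_associatedPrime (R := R) (Ideal.span {e} : Ideal R)
    obtain ⟨⟨y, hy⟩, hyp⟩ := ass_exists hass
    have hyp : ∀ a, a ∈ p ↔ a * y = 0 := fun a => (hyp a).trans Subtype.ext_iff
    obtain ⟨x, rfl⟩ := Ideal.mem_span_singleton'.1 hy
    have hDp : D ∉ p := by
      intro hDp
      rw [hyp] at hDp
      apply hp.ne_top
      rw [Ideal.eq_top_iff_one, hyp, one_mul]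
      apply hstab
      rw [← hDp, he]
      ring
    have h0p : ∀ i, ∑ j ∈ I 0, A i j ∈ p := by
      intro i
      rw [hyp]
      calc (∑ j ∈ I 0, A i j) * (x * e) = x * D ^ n * (d 0 * ∑ j ∈ I 0, A i j) := by
            rw [he]; ring
        _ = 0 := by rw [h0, mul_zero]
    have key : ∀ t : Fin (m + 1), ∃ v : Fin l → R, (∀ j, f j = t → v j = D) ∧
        (∀ j, t < f j → v j = 0) ∧ ∀ i, ∑ j, A i j * v j ∈ p := by
      intro t
      rcases Fin.eq_zero_or_eq_succ t with ht | ⟨t', ht⟩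
      · refine ⟨fun j => if f j = t then D else 0, fun j hj => if_pos hj,
          fun j hj => if_neg hj.ne', fun i => ?_⟩
        have : ∑ j, A i j * (if f j = t then D else 0) = (∑ j ∈ I 0, A i j) * D := by
          have hI : I 0 = Finset.univ.filter (fun j => f j = t) := by
            ext j
            simp [hfI, ht]
          rw [hI, Finset.sum_mul, Finset.sum_filter]
          exact Finset.sum_congr rfl fun j _ => by split_ifs <;> simp
        rw [this]
        exact Ideal.mul_mem_right _ _ (h0p i)
      · have htpos : 0 < t := by rw [ht]; exact Fin.succ_pos _
        obtain ⟨c, hc, hc'⟩ := span_coeff _ _ _ (hspan t htpos)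
        have hc0 : ∀ j, t ≤ f j → c j = 0 := by
          intro j hj
          apply hc
          rintro ⟨t'', ht'', hjt⟩
          rw [hfI] at hjt
          rw [hjt] at hj
          exact absurd ht'' (not_lt.2 hj)
        obtain ⟨E, hE⟩ : d t ∣ D := Finset.dvd_prod_of_mem _ (by simpa using htpos.ne')
        refine ⟨fun j => if f j = t then D else - (E * c j), fun j hj => if_pos hj,
          fun j hj => ?_, fun i => ?_⟩
        · simp only []
          rw [if_neg hj.ne', hc0 j hj.le, mul_zero, neg_zero]
        · have h1 := congrFun hc' i
          simp only [Finset.sum_apply, Pi.smul_apply, smul_eq_mul] at h1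
          have hI : I t = Finset.univ.filter (fun j => f j = t) := by
            ext j
            simp [hfI]
          have : ∑ j, A i j * (if f j = t then D else - (E * c j)) =
              E * (d t * ∑ j ∈ I t, A i j) - E * ∑ j, c j * A i j := by
            rw [hI, Finset.sum_filter, Finset.mul_sum, Finset.mul_sum, Finset.mul_sum,
              ← Finset.sum_sub_distrib]
            refine Finset.sum_congr rfl fun j _ => ?_
            split_ifs with hj
            · rw [hc0 j hj.ge, hE]; ring
            · ring
          rw [this, h1, sub_self]
          exact p.zero_mem
    choose v hv1 hv2 hv3 using key
    refine pr_of_quotient hyp ?_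
    refine pr_of_kernel_vectors (S := R ⧸ p) A hl (m + 1) (fun j => (f j : ℕ))
      (fun j => (f j).isLt) (Ideal.Quotient.mk p D)
      (fun h => hDp (Ideal.Quotient.eq_zero_iff_mem.1 h))
      (fun t j => if ht : t < m + 1 then Ideal.Quotient.mk p (v ⟨t, ht⟩ j) else 0) ?_ ?_ ?_ ?_
    · intro t ht i
      simp only [dif_pos ht]
      have := Ideal.Quotient.eq_zero_iff_mem.2 (hv3 ⟨t, ht⟩ i)
      rw [map_sum] at this
      exact this
    · intro t j hj
      have ht : t < m + 1 := hj ▸ (f j).isLt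
      simp only [dif_pos ht]
      rw [hv1 _ _ (Fin.ext hj)]
    · intro t j hj
      have ht : t < m + 1 := hj.trans (f j).isLt
      simp only [dif_pos ht]
      rw [hv2 ⟨t, ht⟩ j hj, map_zero]
    · intro t j hj
      simp only [dif_neg (not_lt.2 hj)]

theorem order_to_fin {L : Type*} [LinearOrder L] {l : ℕ} (hl : 0 < l) (f : Fin l → L) :
    ∃ (m : ℕ) (g : Fin l → Fin (m + 1)), Function.Surjective g ∧
      ∀ j j', g j < g j' ↔ f j < f j' := by
  classical
  let s : Finset L := Finset.univ.image f
  have hmem : ∀ j, f j ∈ s := fun j => Finset.mem_image_of_mem _ (Finset.mem_univ _)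
  have hs : s.card = s.card - 1 + 1 := by
    have : 0 < s.card := Finset.card_pos.2 ⟨_, hmem ⟨0, hl⟩⟩
    omega
  let e := s.orderIsoOfFin hs
  refine ⟨s.card - 1, fun j => e.symm ⟨f j, hmem j⟩, ?_, ?_⟩
  · intro t
    obtain ⟨j, -, hj⟩ := Finset.mem_image.1 (e t).2
    refine ⟨j, ?_⟩
    rw [OrderIso.symm_apply_eq]
    exact Subtype.ext hj
  · intro j j'
    rw [OrderIso.lt_iff_lt]
    rfl


theorem gcc_of_const {R : Type*} [CommRing R] {k l : ℕ} {A : Matrix (Fin k) (Fin l) R}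
    (hl : 0 < l) {p : Ideal R} (hp : p ≠ ⊤) {x : R} (hx : ∀ a, a ∈ p ↔ a * x = 0)
    (h : ∀ i, ∑ j, A i j ∈ p) : GenColumnsCondition A := by
  refine ⟨0, fun _ => Finset.univ, fun _ => x, fun _ => ⟨⟨0, hl⟩, Finset.mem_univ _⟩, ?_,
    fun j => ⟨0, Finset.mem_univ _⟩, ?_, ?_, ?_, ?_⟩
  · intro t t' htt
    exact absurd (Fin.ext (by omega)) htt
  · intro _ h0
    apply hp
    have h0 : x = 0 := h0
    rw [Ideal.eq_top_iff_one, hx, h0, mul_zero]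
  · intro i
    rw [mul_comm]
    exact (hx _).1 (h i)
  · intro t ht
    exact absurd ht (by rw [Fin.lt_def]; simp only [Fin.val_zero]; omega)
  · intro h0
    exact absurd h0 (lt_irrefl 0)

theorem field_of_ann {R : Type*} [CommRing R] (p : Ideal R) [p.IsPrime] {s : R} (hs : s ∉ p)
    (h : ∀ a ∈ p, s * a = 0) : IsField (Localization.AtPrime p) := by
  rw [IsLocalRing.isField_iff_maximalIdeal_eq, ← Localization.AtPrime.map_eq_maximalIdeal,
    eq_bot_iff, Ideal.map_le_iff_le_comap]
  intro a ha
  rw [Ideal.mem_comap, Ideal.mem_bot, IsLocalization.map_eq_zero_iff p.primeCompl]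
  exact ⟨⟨s, hs⟩, h a ha⟩

theorem ann_of_field {R : Type*} [CommRing R] [IsNoetherianRing R] (p : Ideal R) [hp : p.IsPrime]
    (h : IsField (Localization.AtPrime p)) : ∃ s, s ∉ p ∧ ∀ a ∈ p, s * a = 0 := by
  rw [IsLocalRing.isField_iff_maximalIdeal_eq, ← Localization.AtPrime.map_eq_maximalIdeal,
    eq_bot_iff, Ideal.map_le_iff_le_comap] at h
  have h1 : ∀ a ∈ p, ∃ s : p.primeCompl, s * a = 0 := by
    intro a ha
    have := h ha
    rwa [Ideal.mem_comap, Ideal.mem_bot, IsLocalization.map_eq_zero_iff p.primeCompl] at this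
  obtain ⟨n, g, hg⟩ := Submodule.fg_iff_exists_fin_generating_family.1
    (IsNoetherian.noetherian p)
  have hgp : ∀ i, g i ∈ p := fun i => hg ▸ Submodule.subset_span ⟨i, rfl⟩
  choose s hs using fun i => h1 (g i) (hgp i)
  refine ⟨((∏ i, s i : p.primeCompl) : R), (∏ i, s i : p.primeCompl).2, fun a ha => ?_⟩
  rw [← hg] at ha
  refine Submodule.span_induction ?_ ?_ ?_ ?_ ha
  · rintro _ ⟨i, rfl⟩
    obtain ⟨c, hc⟩ : s i ∣ ∏ i, s i := Finset.dvd_prod_of_mem _ (Finset.mem_univ i)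
    rw [hc, Submonoid.coe_mul, mul_right_comm, hs, zero_mul]
  · simp
  · intro a b _ _ ha hb
    rw [mul_add, ha, hb, add_zero]
  · intro r a _ ha
    rw [smul_eq_mul, mul_left_comm, ha, mul_zero]

theorem mem_of_fractionRing {R : Type*} [CommRing R] (p : Ideal R) [p.IsPrime] {a : R}
    (h : algebraMap R (FractionRing (R ⧸ p)) a = 0) : a ∈ p := by
  rw [IsScalarTower.algebraMap_apply R (R ⧸ p) (FractionRing (R ⧸ p))] at h
  exact Ideal.Quotient.eq_zero_iff_mem.1
    ((map_eq_zero_iff _ (IsFractionRing.injective (R ⧸ p) (FractionRing (R ⧸ p)))).1 h)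

theorem clear_denominators {R : Type*} [CommRing R] (p : Ideal R) [p.IsPrime] {k l : ℕ}
    (A : Matrix (Fin k) (Fin l) R) (T : Finset (Fin l)) (E : Set (Fin l))
    (h : (∑ j ∈ T, fun i => algebraMap R (FractionRing (R ⧸ p)) (A i j)) ∈
      Submodule.span (FractionRing (R ⧸ p))
        ((fun j (i : Fin k) => algebraMap R (FractionRing (R ⧸ p)) (A i j)) '' E)) :
    ∃ (d : R) (c : Fin l → R), d ∉ p ∧ (∀ j, j ∉ E → c j = 0) ∧
      ∀ i, d * ∑ j ∈ T, A i j - ∑ j, c j * A i j ∈ p := by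
  classical
  obtain ⟨c, hc, hc'⟩ := span_coeff _ _ _ h
  obtain ⟨b, hb⟩ := IsLocalization.exist_integer_multiples_of_finite (nonZeroDivisors (R ⧸ p)) c
  choose c1 hc1 using hb
  obtain ⟨d, hd⟩ := Ideal.Quotient.mk_surjective (b : R ⧸ p)
  choose c2 hc2 using fun j => Ideal.Quotient.mk_surjective (I := p) (c1 j)
  have hdK : algebraMap R (FractionRing (R ⧸ p)) d = algebraMap (R ⧸ p) _ (b : R ⧸ p) := by
    rw [IsScalarTower.algebraMap_apply R (R ⧸ p) (FractionRing (R ⧸ p)), ← hd]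
    rfl
  have hcK : ∀ j, algebraMap R (FractionRing (R ⧸ p)) (c2 j) =
      algebraMap R (FractionRing (R ⧸ p)) d * c j := by
    intro j
    rw [hdK, ← Algebra.smul_def, ← hc1, ← hc2,
      IsScalarTower.algebraMap_apply R (R ⧸ p) (FractionRing (R ⧸ p))]
    rfl
  refine ⟨d, fun j => if j ∈ E then c2 j else 0, ?_, fun j hj => if_neg hj, fun i => ?_⟩
  · intro hdp
    rw [Ideal.Quotient.eq_zero_iff_mem.2 hdp] at hd
    exact nonZeroDivisors.coe_ne_zero b hd.symm
  · apply mem_of_fractionRing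
    have h1 := congrFun hc' i
    simp only [Finset.sum_apply, Pi.smul_apply, smul_eq_mul] at h1
    rw [map_sub, map_mul, map_sum, map_sum, h1, Finset.mul_sum, ← Finset.sum_sub_distrib]
    refine Finset.sum_eq_zero fun j _ => ?_
    beta_reduce
    split_ifs with hj
    · rw [map_mul, hcK]; ring
    · rw [hc j hj]; simp

theorem gcc_of_pr {R : Type u} [CommRing R] [IsNoetherianRing R]
    (H : ∀ (p : Ideal R) [p.IsPrime], IsAssociatedPrime p R →
        ((Finite (R ⧸ p) ∧ IsField (R ⧸ p)) ∨ IsField (Localization.AtPrime p)))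
    {k l : ℕ} {A : Matrix (Fin k) (Fin l) R} (h : IsPRAll A R) : GenColumnsCondition A := by
  classical
  have hl : 0 < l := by
    rcases Nat.eq_zero_or_pos l with rfl | hl
    · obtain ⟨m, hm, -⟩ := h 1 le_rfl (fun _ => 0)
      exact absurd (Subsingleton.elim _ _) hm
    · exact hl
  obtain ⟨p, hp, hass, hK⟩ := h.exists_associatedPrime
  obtain ⟨x, hx⟩ := ass_exists hass
  by_cases hfin : Finite (R ⧸ p)
  · have : Finite (FractionRing (R ⧸ p)) :=
      Finite.of_surjective (algebraMap (R ⧸ p) (FractionRing (R ⧸ p)))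
        (IsFractionRing.surjective_iff_isField.2 (Finite.isField_of_domain (R ⧸ p)))
    obtain ⟨m, hm, hA, hmono⟩ := hK.finite_colour (fun x => x)
    refine gcc_of_const hl hp.ne_top hx fun i => mem_of_fractionRing p ?_
    have hm0 : m ⟨0, hl⟩ ≠ 0 := by
      intro h0
      exact hm (funext fun j => (hmono j ⟨0, hl⟩).trans h0)
    have h1 := hA i
    simp only [fun j => hmono j ⟨0, hl⟩] at h1
    rw [← Finset.sum_smul, Algebra.smul_def] at h1
    exact (mul_eq_zero.1 h1).resolve_right hm0
  · have hinf : Infinite (R ⧸ p) := not_finite_iff_infinite.1 hfin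
    obtain ⟨s, hs, hsp⟩ := ann_of_field p ((H p hass).resolve_left fun h => hfin h.1)
    obtain ⟨L, _, f, hf⟩ := columns_of_pr_field A hK
    obtain ⟨m, g, hg, hgf⟩ := order_to_fin hl f
    have hgeq : ∀ j j', g j = g j' ↔ f j = f j' := by
      intro j j'
      have h1 := hgf j j'
      have h2 := hgf j' j
      constructor
      · intro h
        exact le_antisymm (not_lt.1 fun h' => (h2.2 h').ne h.symm)
          (not_lt.1 fun h' => (h1.2 h').ne h)
      · intro h
        exact le_antisymm (not_lt.1 fun h' => (h2.1 h').ne h.symm)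
          (not_lt.1 fun h' => (h1.1 h').ne h)
    have key : ∀ t, ∃ (d : R) (c : Fin l → R), d ∉ p ∧ (∀ j, ¬ g j < t → c j = 0) ∧
        ∀ i, d * ∑ j with g j = t, A i j - ∑ j, c j * A i j ∈ p := by
      intro t
      obtain ⟨j0, rfl⟩ := hg t
      have h1 := hf j0
      simp only [← hgeq, ← hgf] at h1
      exact clear_denominators p A _ _ h1
    choose d c hd hc hdc using key
    have hdp : ∀ t, s * d t ∉ p := fun t ht => (hp.mem_or_mem ht).elim hs (hd t)
    have heq : ∀ t i, s * d t * ∑ j with g j = t, A i j = ∑ j, s * c t j * A i j := by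
      intro t i
      have := hsp _ (hdc t i)
      rw [mul_sub, sub_eq_zero, Finset.mul_sum (s := Finset.univ)] at this
      rw [mul_assoc, this]
      exact Finset.sum_congr rfl fun j _ => (mul_assoc _ _ _).symm
    refine ⟨m, fun t => Finset.univ.filter fun j => g j = t, fun t => s * d t, ?_, ?_, ?_, ?_, ?_,
      ?_, ?_⟩
    · intro t
      obtain ⟨j, hj⟩ := hg t
      exact ⟨j, by simpa using hj⟩
    · intro t t' htt
      rw [Finset.disjoint_left]
      intro j h1 h2
      simp only [Finset.mem_filter, Finset.mem_univ, true_and] at h1 h2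
      exact htt (h1.symm.trans h2)
    · intro j
      exact ⟨g j, by simp⟩
    · intro t h0
      have h0 : s * d t = 0 := h0
      exact hdp t (h0 ▸ p.zero_mem)
    · intro i
      rw [heq]
      exact Finset.sum_eq_zero fun j _ => by rw [hc 0 j (Fin.not_lt_zero _)]; simp
    · intro t ht
      have h1 : (fun i : Fin k => s * d t * ∑ j with g j = t, A i j) =
          ∑ j, (s * c t j) • fun i => A i j := by
        funext i
        simp [heq]
      rw [h1]
      refine Submodule.sum_mem _ fun j _ => ?_
      by_cases hj : g j < t
      · exact Submodule.smul_mem _ _ (Submodule.subset_span ⟨j, ⟨g j, hj, by simp⟩, rfl⟩)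
      · rw [hc t j hj]
        simp
    · intro _ n
      set z := s * d 0 * (∏ t ∈ Finset.univ.filter (fun t => t ≠ 0), s * d t) ^ n with hz
      have hzp : z ∉ p := by
        intro hzp
        rcases hp.mem_or_mem hzp with h1 | h1
        · exact hdp 0 h1
        · obtain ⟨t, -, ht⟩ := (Ideal.IsPrime.prod_mem_iff).1 (hp.mem_of_pow_mem _ h1)
          exact hdp t ht
      refine Set.Infinite.of_image (Ideal.Quotient.mk p) ?_
      have hinj : Function.Injective fun r : R ⧸ p => Ideal.Quotient.mk p z * r :=
        mul_right_injective₀ fun h0 => hzp (Ideal.Quotient.eq_zero_iff_mem.1 h0)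
      refine (Set.infinite_range_of_injective hinj).mono ?_
      rintro _ ⟨r, rfl⟩
      obtain ⟨r, rfl⟩ := Ideal.Quotient.mk_surjective r
      exact ⟨z * r, ⟨r, rfl⟩, map_mul _ _ _⟩

theorem field_of_rado {R : Type u} [CommRing R] [IsNoetherianRing R] (H : IsRadoRing R)
    (p : Ideal R) [hp : p.IsPrime] (hass : IsAssociatedPrime p R) (hinf : Infinite (R ⧸ p)) :
    IsField (Localization.AtPrime p) := by
  classical
  by_contra hfield
  have hann : ∀ s, (∀ a ∈ p, s * a = 0) → s ∈ p := by
    intro s hs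
    by_contra hsp
    exact hfield (field_of_ann p hsp hs)
  obtain ⟨x, hx⟩ := ass_exists hass
  obtain ⟨n, a, ha⟩ := Submodule.fg_iff_exists_fin_generating_family.1
    (IsNoetherian.noetherian p)
  have hap : ∀ i, a i ∈ p := fun i => ha ▸ Submodule.subset_span ⟨i, rfl⟩
  let e := Fintype.equivFin (Option (Fin n × Fin 3))
  let B : Option (Fin n × Fin 3) → Fin 3 → R := fun o j =>
    o.elim ((![1, 1, -1] : Fin 3 → R) j) fun q => if j = q.2 then a q.1 else 0
  let A : Matrix (Fin (Fintype.card (Option (Fin n × Fin 3)))) (Fin 3) R := fun i j => B (e.symm i) j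
  have hPR : IsPRAll A R := by
    refine pr_of_quotient hx ?_
    let w : ℕ → Fin 3 → R ⧸ p := fun t =>
      if t = 0 then ![1, 0, 1] else if t = 1 then ![0, 1, 1] else 0
    refine pr_of_kernel_vectors (S := R ⧸ p) A (by norm_num) 2 ![0, 1, 0] ?_ 1 one_ne_zero w
      ?_ ?_ ?_ ?_
    · intro j
      fin_cases j <;> simp
    · intro t ht i
      change ∑ j, B (e.symm i) j • w t j = 0
      rcases e.symm i with _ | ⟨i', j'⟩
      · interval_cases t <;> simp [B, w, Fin.sum_univ_three]
      · refine Finset.sum_eq_zero fun j _ => ?_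
        have : ∀ y : R ⧸ p, a i' • y = 0 := by
          intro y
          rw [Algebra.smul_def]
          have h0 : algebraMap R (R ⧸ p) (a i') = 0 := Ideal.Quotient.eq_zero_iff_mem.2 (hap i')
          rw [h0, zero_mul]
        simp only [B, Option.elim_some]
        split_ifs
        · exact this _
        · exact zero_smul _ _
    · rintro t j rfl
      fin_cases j <;> simp [w]
    · intro t j ht
      fin_cases j
      · simp at ht
      · have : t = 0 := by simpa using ht
        simp [w, this]
      · simp at ht
    · intro t j ht
      have h0 : t ≠ 0 := by omega
      have h1 : t ≠ 1 := by omega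
      simp [w, h0, h1]
  obtain ⟨m, I, d, hne, hdisj, hcov, hd, h0, hspan, hI⟩ := (H _ _ A).1 hPR
  rcases Nat.eq_zero_or_pos m with rfl | hm
  · have hIuniv : I 0 = Finset.univ := by
      ext j
      obtain ⟨t, ht⟩ := hcov j
      have : t = 0 := Fin.ext (by have := t.isLt; simp only [Fin.val_zero]; omega)
      simpa [this] using ht
    have h1 := h0 (e none)
    rw [hIuniv] at h1
    apply hd 0
    simpa [A, B, Fin.sum_univ_three] using h1
  · have hdt : ∀ t, 0 < t → ∀ b ∈ p, d t * b = 0 := by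
      intro t ht b hb
      rw [← ha] at hb
      refine Submodule.span_induction ?_ ?_ ?_ ?_ hb
      · rintro _ ⟨i, rfl⟩
        obtain ⟨j, hj⟩ := hne t
        obtain ⟨c, hc, hc'⟩ := span_coeff _ _ _ (hspan t ht)
        have h1 := congrFun hc' (e (some (i, j)))
        simp only [Finset.sum_apply, Pi.smul_apply, smul_eq_mul, A, B, Equiv.symm_apply_apply,
          Option.elim_some] at h1
        rw [Finset.sum_ite_eq' (I t) j, if_pos hj] at h1
        rw [h1]
        refine Finset.sum_eq_zero fun j' _ => ?_
        split_ifs with hjj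
        · rw [hc j', zero_mul]
          rintro ⟨t', ht', hj'⟩
          rw [hjj] at hj'
          exact Finset.disjoint_left.1 (hdisj _ _ ht'.ne) hj' hj
        · rw [mul_zero]
      · simp
      · intro a b _ _ ha hb
        rw [mul_add, ha, hb, add_zero]
      · intro r a _ ha
        rw [smul_eq_mul, mul_left_comm, ha, mul_zero]
    set D := ∏ t ∈ Finset.univ.filter (fun t => t ≠ 0), d t with hD
    have hlast : (0 : Fin (m + 1)) < Fin.last m := by
      rw [Fin.lt_def]
      simpa using hm
    obtain ⟨E, hE⟩ : d (Fin.last m) ∣ D :=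
      Finset.dvd_prod_of_mem _ (by simpa using hlast.ne')
    have hDp : D ∈ p := by
      rw [hE]
      exact Ideal.mul_mem_right _ _ (hann _ (hdt _ hlast))
    have hD2 : D ^ 2 = 0 := by
      rw [pow_two]
      nth_rewrite 1 [hE]
      rw [mul_right_comm, hdt _ hlast D hDp, zero_mul]
    apply hI hm 2
    rw [hD2]
    simp only [mul_zero, zero_mul]
    exact Set.finite_range_const

end Final

theorem isRadoRing_iff {R : Type*} [CommRing R] [IsNoetherianRing R] :
    IsRadoRing R ↔
      ∀ (p : Ideal R) [p.IsPrime], IsAssociatedPrime p R →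
        ((Finite (R ⧸ p) ∧ IsField (R ⧸ p)) ∨ IsField (Localization.AtPrime p)) := by
  constructor
  · intro H p _ hass
    by_cases hfin : Finite (R ⧸ p)
    · exact Or.inl ⟨hfin, Finite.isField_of_domain (R ⧸ p)⟩
    · exact Or.inr (field_of_rado H p hass (not_finite_iff_infinite.1 hfin))
  · intro H k l A
    exact ⟨fun h => gcc_of_pr H h, fun h => pr_of_gcc h⟩
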